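/- Let g ∈ G = SL(2,ℝ) with g ∉ K, let λ > 2, 0 < η < λ, b ≥ 0, Q > 1, and let f be a left K-invariant positive continuous function on G (i.e. f(kh) = f(h) for all k ∈ K, h ∈ G). Assume: (i) (A_g f)(h) ≤ τ_λ(g)·f(h) + b·τ_η(h) for all h ∈ G, where G acts on itself by left translations (so (A_g f)(h) = ∫_K f(gkh) dσ(k)); and (ii) f(yh) ≤ Q·f(h) whenever h, y ∈ G and ‖y‖ ≤ ‖g‖. Then for all h ∈ G: ∫_K f(hk) dσ(k) ≤ s·τ_λ(h), where s = Q·[ f(1) + b/(τ_λ(g) − τ_η(g)) ] (note τ_λ(g) > τ_η(g) since g ∉ K). -/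

import Mathlib

open Matrix

noncomputable def opNorm {n : ℕ} (M : Matrix (Fin n) (Fin n) ℝ) : ℝ :=
  sSup {x | ∃ v : Fin n → ℝ, Real.sqrt (v ⬝ᵥ v) ≤ 1 ∧
    x = Real.sqrt ((M *ᵥ v) ⬝ᵥ (M *ᵥ v))}

/-- The rotation `k(θ) ∈ K = SO(2)`. -/
noncomputable def kmat (θ : ℝ) : Matrix (Fin 2) (Fin 2) ℝ :=
  !![Real.cos θ, -Real.sin θ; Real.sin θ, Real.cos θ]

/-- `τ_λ(g) = ∫_K ‖g k e₁‖^{−λ} dσ(k)` with `σ` the normalized Haar measure on `K`. -/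
noncomputable def tau (lam : ℝ) (g : Matrix (Fin 2) (Fin 2) ℝ) : ℝ :=
  (2 * Real.pi)⁻¹ * ∫ θ in (0:ℝ)..(2 * Real.pi),
    (Real.sqrt ((g *ᵥ (kmat θ *ᵥ ![1, 0])) ⬝ᵥ (g *ᵥ (kmat θ *ᵥ ![1, 0])))) ^ (-lam)

/-- `(A_g f)(h) = ∫_K f(g k h) dσ(k)` for the action of `G` on itself by left translations. -/
noncomputable def Ag (g : Matrix (Fin 2) (Fin 2) ℝ)
    (f : Matrix (Fin 2) (Fin 2) ℝ → ℝ) (h : Matrix (Fin 2) (Fin 2) ℝ) : ℝ :=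
  (2 * Real.pi)⁻¹ * ∫ θ in (0:ℝ)..(2 * Real.pi), f (g * kmat θ * h)

local notation "M₂" => Matrix (Fin 2) (Fin 2) ℝ

/-- The mean of `F` over `SO(2)` with respect to the normalized Haar measure. -/
noncomputable def rotMean (F : Matrix (Fin 2) (Fin 2) ℝ → ℝ) : ℝ :=
  (2 * Real.pi)⁻¹ * ∫ θ in (0:ℝ)..(2 * Real.pi), F (kmat θ)

/-- The diagonal matrix with entries `exp t` and `exp (-t)`. -/
noncomputable def diagMat (t : ℝ) : Matrix (Fin 2) (Fin 2) ℝ :=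
  !![Real.exp t, 0; 0, Real.exp (-t)]

section Matrices

theorem det_kmat (θ : ℝ) : (kmat θ).det = 1 := by
  simp [kmat, Matrix.det_fin_two]
  nlinarith [Real.sin_sq_add_cos_sq θ]

theorem kmat_add (θ φ : ℝ) : kmat (θ + φ) = kmat θ * kmat φ := by
  ext i j
  fin_cases i <;> fin_cases j <;>
    simp [kmat, Matrix.mul_apply, Fin.sum_univ_two, Real.cos_add, Real.sin_add] <;> ring

theorem kmat_zero : kmat 0 = 1 := by
  ext i j
  fin_cases i <;> fin_cases j <;> simp [kmat]

theorem kmat_neg_mul (θ : ℝ) : kmat (-θ) * kmat θ = 1 := by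
  rw [← kmat_add, neg_add_cancel, kmat_zero]

theorem kmat_mul_neg (θ : ℝ) : kmat θ * kmat (-θ) = 1 := by
  rw [← kmat_add, add_neg_cancel, kmat_zero]

theorem kmat_periodic : Function.Periodic kmat (2 * Real.pi) := by
  intro θ
  simp [kmat]

theorem continuous_kmat : Continuous kmat := by
  refine continuous_matrix fun i j => ?_
  fin_cases i <;> fin_cases j <;> simp [kmat] <;> fun_prop

theorem det_diagMat (t : ℝ) : (diagMat t).det = 1 := by
  simp [diagMat, Matrix.det_fin_two, ← Real.exp_add]

theorem diagMat_add (s t : ℝ) : diagMat (s + t) = diagMat s * diagMat t := by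
  ext i j
  fin_cases i <;> fin_cases j <;>
    simp [diagMat, Matrix.mul_apply, Fin.sum_univ_two, Real.exp_add, mul_comm]

theorem diagMat_zero : diagMat 0 = 1 := by
  ext i j
  fin_cases i <;> fin_cases j <;> simp [diagMat]

theorem continuous_diagMat : Continuous diagMat := by
  refine continuous_matrix fun i j => ?_
  fin_cases i <;> fin_cases j <;> simp [diagMat] <;> fun_prop

theorem exists_polar (x y : ℝ) :
    ∃ φ : ℝ, x = √(x ^ 2 + y ^ 2) * Real.cos φ ∧ y = √(x ^ 2 + y ^ 2) * Real.sin φ := by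
  refine ⟨Complex.arg ⟨x, y⟩, ?_⟩
  have h := Complex.norm_mul_cos_arg ⟨x, y⟩
  have h' := Complex.norm_mul_sin_arg ⟨x, y⟩
  rw [Complex.norm_def, Complex.normSq_mk, ← sq, ← sq] at h h'
  exact ⟨h.symm, h'.symm⟩

/-- The Cartan decomposition of `SL(2, ℝ)`. -/
theorem exists_cartan (h : M₂) (hh : h.det = 1) :
    ∃ θ φ t : ℝ, 0 ≤ t ∧ h = kmat θ * diagMat t * kmat φ := by
  obtain ⟨α, hα₁, hα₂⟩ := exists_polar ((h 0 0 + h 1 1) / 2) ((h 1 0 - h 0 1) / 2)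
  obtain ⟨β, hβ₁, hβ₂⟩ := exists_polar ((h 0 0 - h 1 1) / 2) ((h 1 0 + h 0 1) / 2)
  rw [Matrix.det_fin_two] at hh
  set A := √(((h 0 0 + h 1 1) / 2) ^ 2 + ((h 1 0 - h 0 1) / 2) ^ 2) with hA
  set B := √(((h 0 0 - h 1 1) / 2) ^ 2 + ((h 1 0 + h 0 1) / 2) ^ 2) with hB
  have hA0 : 0 ≤ A := Real.sqrt_nonneg _
  have hB0 : 0 ≤ B := Real.sqrt_nonneg _
  have hA2 : A ^ 2 = ((h 0 0 + h 1 1) / 2) ^ 2 + ((h 1 0 - h 0 1) / 2) ^ 2 :=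
    Real.sq_sqrt (by positivity)
  have hB2 : B ^ 2 = ((h 0 0 - h 1 1) / 2) ^ 2 + ((h 1 0 + h 0 1) / 2) ^ 2 :=
    Real.sq_sqrt (by positivity)
  have hAB : (A + B) * (A - B) = 1 := by nlinarith
  have hA1 : 1 ≤ A := by nlinarith
  have hpos : 0 < A + B := by linarith
  have hexp : Real.exp (Real.log (A + B)) = A + B := Real.exp_log hpos
  have hexp' : Real.exp (-Real.log (A + B)) = A - B := by
    rw [Real.exp_neg, hexp]
    field_simp
    linarith
  refine ⟨(α + β) / 2, (α - β) / 2, Real.log (A + B), Real.log_nonneg (by linarith), ?_⟩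
  have e₁ : α = (α + β) / 2 + (α - β) / 2 := by ring
  have e₂ : β = (α + β) / 2 - (α - β) / 2 := by ring
  rw [e₁, Real.cos_add] at hα₁
  rw [e₁, Real.sin_add] at hα₂
  rw [e₂, Real.cos_sub] at hβ₁
  rw [e₂, Real.sin_sub] at hβ₂
  ring_nf at hα₁ hα₂ hβ₁ hβ₂
  ext i j
  fin_cases i <;> fin_cases j <;>
    simp [kmat, diagMat, Matrix.mul_apply, Fin.sum_univ_two, hexp, hexp'] <;> ring_nf <;>
    linarith

theorem exists_cartan_diagMat_mul (s t θ : ℝ) (hs : 0 ≤ s) (ht : 0 ≤ t) :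
    ∃ r ∈ Set.Icc 0 (s + t), ∃ α β : ℝ,
      diagMat s * kmat θ * diagMat t = kmat α * diagMat r * kmat β := by
  obtain ⟨α, β, r, hr, h⟩ := exists_cartan (diagMat s * kmat θ * diagMat t)
    (by simp [det_diagMat, det_kmat])
  refine ⟨r, ⟨hr, ?_⟩, α, β, h⟩
  have htr : ∀ X Y : M₂, X = Y → (Xᵀ * X).trace = (Yᵀ * Y).trace := by
    rintro X _ rfl
    rfl
  have h' := htr _ _ h
  simp only [kmat, diagMat, Matrix.trace_fin_two, Matrix.mul_apply, Fin.sum_univ_two,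
    Matrix.transpose_apply, Matrix.of_apply, Matrix.cons_val', Matrix.cons_val_zero,
    Matrix.cons_val_one, Matrix.cons_val_fin_one] at h'
  have hcosh : Real.cosh (2 * r) ≤ Real.cosh (2 * (s + t)) := by
    have e (x : ℝ) : Real.cosh (2 * x) = (Real.exp x ^ 2 + Real.exp (-x) ^ 2) / 2 := by
      rw [Real.cosh_eq, ← Real.exp_nat_mul, ← Real.exp_nat_mul]
      push_cast
      ring_nf
    rw [e, e, neg_add, Real.exp_add, Real.exp_add]
    have hα := Real.sin_sq_add_cos_sq α
    have hβ := Real.sin_sq_add_cos_sq β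
    have hθ := Real.sin_sq_add_cos_sq θ
    have h₁ : Real.exp (-s) ≤ Real.exp s := Real.exp_le_exp.2 (by linarith)
    have h₂ : Real.exp (-t) ≤ Real.exp t := Real.exp_le_exp.2 (by linarith)
    have h₁' : Real.exp (-s) ^ 2 ≤ Real.exp s ^ 2 := by gcongr
    have h₂' : Real.exp (-t) ^ 2 ≤ Real.exp t ^ 2 := by gcongr
    have hprod := mul_nonneg (sub_nonneg.2 h₁') (sub_nonneg.2 h₂')
    have hR : Real.exp r ^ 2 + Real.exp (-r) ^ 2
        = (Real.exp s ^ 2 * Real.exp t ^ 2 + Real.exp (-s) ^ 2 * Real.exp (-t) ^ 2)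
            * Real.cos θ ^ 2
          + (Real.exp s ^ 2 * Real.exp (-t) ^ 2 + Real.exp (-s) ^ 2 * Real.exp t ^ 2)
            * Real.sin θ ^ 2 := by
      have hc : Real.exp r ^ 2 + Real.exp (-r) ^ 2 =
          (Real.sin α ^ 2 + Real.cos α ^ 2) * (Real.sin β ^ 2 + Real.cos β ^ 2) *
          (Real.exp r ^ 2 + Real.exp (-r) ^ 2) := by rw [hα, hβ]; ring
      rw [hc]
      linear_combination -h'
    rw [hR]
    have := mul_nonneg hprod (sq_nonneg (Real.sin θ))
    nlinarith
  rw [Real.cosh_le_cosh, abs_of_nonneg (by linarith), abs_of_nonneg (by linarith)] at hcosh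
  linarith

theorem kmat_mulVec_dotProduct (θ : ℝ) (v : Fin 2 → ℝ) :
    (kmat θ *ᵥ v) ⬝ᵥ (kmat θ *ᵥ v) = v ⬝ᵥ v := by
  simp [kmat, dotProduct, Matrix.mulVec, Fin.sum_univ_two]
  linear_combination (v 0 ^ 2 + v 1 ^ 2) * Real.sin_sq_add_cos_sq θ

theorem opNorm_cartan (θ φ t : ℝ) (ht : 0 ≤ t) :
    opNorm (kmat θ * diagMat t * kmat φ) = Real.exp t := by
  refine IsGreatest.csSup_eq ⟨⟨kmat (-φ) *ᵥ ![1, 0], ?_, ?_⟩, ?_⟩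
  · rw [kmat_mulVec_dotProduct]
    simp
  · rw [Matrix.mulVec_mulVec, mul_assoc, kmat_mul_neg, mul_one, ← Matrix.mulVec_mulVec,
      kmat_mulVec_dotProduct]
    simp [diagMat, Matrix.mulVec, dotProduct, Fin.sum_univ_two,
      Real.sqrt_mul_self (Real.exp_pos t).le]
  · rintro _ ⟨v, hv, rfl⟩
    rw [← Matrix.mulVec_mulVec, ← Matrix.mulVec_mulVec, kmat_mulVec_dotProduct]
    rw [← kmat_mulVec_dotProduct φ] at hv
    generalize kmat φ *ᵥ v = w at hv
    rw [Real.sqrt_le_one] at hv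
    refine Real.sqrt_le_iff.2 ⟨(Real.exp_pos t).le, ?_⟩
    have h₂ : Real.exp (-t) ≤ Real.exp t := Real.exp_le_exp.2 (by linarith)
    have h₂' : Real.exp (-t) ^ 2 ≤ Real.exp t ^ 2 := by gcongr
    simp [diagMat, Matrix.mulVec, dotProduct, Fin.sum_univ_two] at hv ⊢
    nlinarith [mul_nonneg (sub_nonneg.2 h₂') (sq_nonneg (w 1)),
      mul_nonneg (sub_nonneg.2 hv) (sq_nonneg (Real.exp t))]

theorem opNorm_diagMat (t : ℝ) (ht : 0 ≤ t) : opNorm (diagMat t) = Real.exp t := by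
  simpa [kmat_zero] using opNorm_cartan 0 0 t ht

end Matrices

section RotMean

theorem rotMean_mul_right (F : M₂ → ℝ) (φ : ℝ) :
    rotMean (fun k => F (k * kmat φ)) = rotMean F := by
  have hper : Function.Periodic (fun θ => F (kmat θ)) (2 * Real.pi) := fun θ => by
    simp only [kmat_periodic θ]
  have h := hper.intervalIntegral_add_eq φ 0
  rw [zero_add] at h
  simp only [rotMean, ← kmat_add]
  rw [intervalIntegral.integral_comp_add_right (fun θ => F (kmat θ)) φ, zero_add,
    add_comm _ φ, h]

theorem rotMean_mul_left (F : M₂ → ℝ) (φ : ℝ) :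
    rotMean (fun k => F (kmat φ * k)) = rotMean F := by
  rw [← rotMean_mul_right F φ]
  simp only [rotMean, ← kmat_add, add_comm]

theorem rotMean_const (c : ℝ) : rotMean (fun _ => c) = c := by
  simp [rotMean]
  field_simp

theorem rotMean_const_mul (c : ℝ) (F : M₂ → ℝ) : rotMean (fun k => c * F k) = c * rotMean F := by
  simp only [rotMean, intervalIntegral.integral_const_mul]
  ring

theorem rotMean_add {F H : M₂ → ℝ} (hF : Continuous fun θ => F (kmat θ))
    (hH : Continuous fun θ => H (kmat θ)) :
    rotMean (fun k => F k + H k) = rotMean F + rotMean H := by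
  simp only [rotMean]
  rw [intervalIntegral.integral_add (hF.intervalIntegrable _ _) (hH.intervalIntegrable _ _)]
  ring

theorem rotMean_congr {F H : M₂ → ℝ} (h : ∀ θ, F (kmat θ) = H (kmat θ)) :
    rotMean F = rotMean H := by
  simp only [rotMean, h]

theorem rotMean_mono {F H : M₂ → ℝ} (hF : Continuous fun θ => F (kmat θ))
    (hH : Continuous fun θ => H (kmat θ)) (h : ∀ θ, F (kmat θ) ≤ H (kmat θ)) :
    rotMean F ≤ rotMean H := by
  refine mul_le_mul_of_nonneg_left ?_ (by positivity)
  exact intervalIntegral.integral_mono (by positivity) (hF.intervalIntegrable _ _)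
    (hH.intervalIntegrable _ _) h

theorem rotMean_lt {F H : M₂ → ℝ} (hF : Continuous fun θ => F (kmat θ))
    (hH : Continuous fun θ => H (kmat θ)) (h : ∀ θ, F (kmat θ) ≤ H (kmat θ))
    (θ : ℝ) (hθ : F (kmat θ) < H (kmat θ)) : rotMean F < rotMean H := by
  rw [← rotMean_mul_right F θ, ← rotMean_mul_right H θ]
  refine mul_lt_mul_of_pos_left ?_ (by positivity)
  simp only [← kmat_add]
  refine intervalIntegral.integral_lt_integral_of_continuousOn_of_le_of_exists_lt
    (by positivity) (hF.comp (continuous_add_const θ)).continuousOn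
    (hH.comp (continuous_add_const θ)).continuousOn (fun x _ => h _)
    ⟨0, ⟨le_rfl, by positivity⟩, by simpa using hθ⟩

theorem rotMean_comm {F : M₂ → M₂ → ℝ}
    (hF : Continuous fun p : ℝ × ℝ => F (kmat p.1) (kmat p.2)) :
    rotMean (fun k => rotMean fun l => F k l) = rotMean fun l => rotMean fun k => F k l := by
  simp only [rotMean, intervalIntegral.integral_const_mul]
  rw [MeasureTheory.intervalIntegral_intervalIntegral_swap]
  refine MeasureTheory.IntegrableOn.mono_set
    (t := Set.uIcc 0 (2 * Real.pi) ×ˢ Set.uIcc 0 (2 * Real.pi)) ?_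
    (Set.prod_mono Set.uIoc_subset_uIcc Set.uIoc_subset_uIcc)
  exact hF.continuousOn.integrableOn_compact (isCompact_uIcc.prod isCompact_uIcc)

theorem continuous_rotMean {X : Type*} [TopologicalSpace X] {F : X → M₂ → ℝ}
    (hF : Continuous fun p : X × ℝ => F p.1 (kmat p.2)) :
    Continuous fun x => rotMean (F x) := by
  unfold rotMean
  exact continuous_const.mul
    (intervalIntegral.continuous_parametric_intervalIntegral_of_continuous' hF _ _)

end RotMean

section Tau

theorem tau_eq (lam : ℝ) (g : M₂) : tau lam g = rotMean fun k =>
    √((g *ᵥ (k *ᵥ ![1, 0])) ⬝ᵥ (g *ᵥ (k *ᵥ ![1, 0]))) ^ (-lam) := rfl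

theorem sqrt_dotProduct_mulVec_pos {g : M₂} (hg : g.det = 1) (θ : ℝ) :
    0 < √((g *ᵥ (kmat θ *ᵥ ![1, 0])) ⬝ᵥ (g *ᵥ (kmat θ *ᵥ ![1, 0]))) := by
  refine Real.sqrt_pos.2 (lt_of_le_of_ne ?_ fun h => ?_)
  · simpa using dotProduct_star_self_nonneg (g *ᵥ (kmat θ *ᵥ ![1, 0]))
  · have h₀ := dotProduct_self_eq_zero.1 h.symm
    rw [Matrix.mulVec_mulVec] at h₀
    have h₁ := Matrix.eq_zero_of_mulVec_eq_zero (by simp [hg, det_kmat]) h₀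
    simpa using congrFun h₁ 0

theorem continuous_tau_integrand (lam : ℝ) {X : Type*} [TopologicalSpace X] {γ : X → M₂}
    (hγ : Continuous γ) (hdet : ∀ x, (γ x).det = 1) {κ : X → ℝ} (hκ : Continuous κ) :
    Continuous fun x => √((γ x *ᵥ (kmat (κ x) *ᵥ ![1, 0])) ⬝ᵥ
      (γ x *ᵥ (kmat (κ x) *ᵥ ![1, 0]))) ^ (-lam) := by
  have hv : Continuous fun x => γ x *ᵥ (kmat (κ x) *ᵥ ![1, 0]) :=
    hγ.matrix_mulVec ((continuous_kmat.comp hκ).matrix_mulVec continuous_const)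
  exact (hv.dotProduct hv).sqrt.rpow_const
    fun x => Or.inl (sqrt_dotProduct_mulVec_pos (hdet x) _).ne'

theorem continuous_tau (lam : ℝ) {X : Type*} [TopologicalSpace X] {γ : X → M₂}
    (hγ : Continuous γ) (hdet : ∀ x, (γ x).det = 1) : Continuous fun x => tau lam (γ x) := by
  simp only [tau_eq]
  exact continuous_rotMean (continuous_tau_integrand lam (hγ.comp continuous_fst)
    (fun p => hdet p.1) continuous_snd)

theorem tau_pos (lam : ℝ) {g : M₂} (hg : g.det = 1) : 0 < tau lam g := by
  have h (θ : ℝ) := Real.rpow_pos_of_pos (sqrt_dotProduct_mulVec_pos hg θ) (-lam)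
  have hlt := rotMean_lt (F := fun _ => 0) (H := fun k =>
      √((g *ᵥ (k *ᵥ ![1, 0])) ⬝ᵥ (g *ᵥ (k *ᵥ ![1, 0]))) ^ (-lam)) continuous_const
    (continuous_tau_integrand lam continuous_const (fun _ => hg) continuous_id)
    (fun θ => (h θ).le) 0 (h 0)
  rwa [rotMean_const] at hlt

theorem tau_kmat_mul (lam θ : ℝ) (g : M₂) : tau lam (kmat θ * g) = tau lam g := by
  simp only [tau_eq, ← Matrix.mulVec_mulVec, kmat_mulVec_dotProduct]

theorem tau_mul_kmat (lam θ : ℝ) (g : M₂) : tau lam (g * kmat θ) = tau lam g := by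
  rw [tau_eq, tau_eq, ← rotMean_mul_left (fun k =>
    √((g *ᵥ (k *ᵥ ![1, 0])) ⬝ᵥ (g *ᵥ (k *ᵥ ![1, 0]))) ^ (-lam)) θ]
  simp only [← Matrix.mulVec_mulVec]

/-- The functions `τ_λ` are spherical functions. -/
theorem rotMean_tau_mul (lam : ℝ) {g h : M₂} (hg : g.det = 1) (hh : h.det = 1) :
    rotMean (fun k => tau lam (g * k * h)) = tau lam g * tau lam h := by
  simp only [tau_eq]
  rw [rotMean_comm]
  · rw [← rotMean_const_mul]
    refine rotMean_congr fun θ => ?_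
    obtain ⟨φ, h₀, h₁⟩ := exists_polar ((h *ᵥ (kmat θ *ᵥ ![1, 0])) 0)
      ((h *ᵥ (kmat θ *ᵥ ![1, 0])) 1)
    have hr := sqrt_dotProduct_mulVec_pos hh θ
    set v := h *ᵥ (kmat θ *ᵥ ![1, 0]) with hv
    have hvv : √(v 0 ^ 2 + v 1 ^ 2) = √(v ⬝ᵥ v) := by
      simp only [dotProduct, Fin.sum_univ_two, sq]
    rw [hvv] at h₀ h₁
    set r := √(v ⬝ᵥ v)
    have hpolar : v = r • (kmat φ *ᵥ ![1, 0]) := by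
      ext i
      fin_cases i
      · simpa [kmat, Matrix.mulVec, dotProduct] using h₀
      · simpa [kmat, Matrix.mulVec, dotProduct] using h₁
    have key : ∀ k : M₂, √(((g * k * h) *ᵥ (kmat θ *ᵥ ![1, 0])) ⬝ᵥ
          ((g * k * h) *ᵥ (kmat θ *ᵥ ![1, 0]))) ^ (-lam) =
        r ^ (-lam) * √((g *ᵥ ((k * kmat φ) *ᵥ ![1, 0])) ⬝ᵥ
          (g *ᵥ ((k * kmat φ) *ᵥ ![1, 0]))) ^ (-lam) := by
      intro k
      rw [← Matrix.mulVec_mulVec _ (g * k) h, ← hv, hpolar,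
        ← Real.mul_rpow hr.le (Real.sqrt_nonneg _)]
      simp only [Matrix.mulVec_smul, smul_dotProduct, dotProduct_smul, smul_eq_mul,
        Matrix.mulVec_mulVec, mul_assoc]
      rw [← mul_assoc, Real.sqrt_mul (by positivity), Real.sqrt_mul_self hr.le]
    simp only [key]
    rw [rotMean_const_mul, rotMean_mul_right fun k =>
      √((g *ᵥ (k *ᵥ ![1, 0])) ⬝ᵥ (g *ᵥ (k *ᵥ ![1, 0]))) ^ (-lam), mul_comm]
  · refine continuous_tau_integrand lam (γ := fun p : ℝ × ℝ => g * kmat p.1 * h) ?_ ?_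
      continuous_snd
    · have := continuous_kmat
      fun_prop
    · simp [hg, hh, det_kmat]

theorem tau_one (lam : ℝ) : tau lam 1 = 1 := by
  rw [tau_eq]
  refine (rotMean_congr fun θ => ?_).trans (rotMean_const 1)
  rw [Matrix.one_mulVec, kmat_mulVec_dotProduct]
  simp

/-- The density `‖diag(eᵗ, e⁻ᵗ) u_θ‖⁻²` on the circle. -/
noncomputable def circleDensity (t θ : ℝ) : ℝ :=
  (Real.exp t ^ 2 * Real.cos θ ^ 2 + Real.exp (-t) ^ 2 * Real.sin θ ^ 2)⁻¹

theorem circleDensity_base_pos (t θ : ℝ) :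
    0 < Real.exp t ^ 2 * Real.cos θ ^ 2 + Real.exp (-t) ^ 2 * Real.sin θ ^ 2 := by
  have h₁ := Real.exp_pos t
  have h₂ := Real.exp_pos (-t)
  rcases eq_or_ne (Real.cos θ) 0 with h | h
  · have := Real.sin_sq_add_cos_sq θ
    have : Real.sin θ ^ 2 = 1 := by simpa [h] using this
    rw [this]
    positivity
  · positivity

theorem circleDensity_pos (t θ : ℝ) : 0 < circleDensity t θ :=
  inv_pos.2 (circleDensity_base_pos t θ)

theorem continuous_circleDensity (t : ℝ) : Continuous (circleDensity t) := by
  unfold circleDensity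
  exact Continuous.inv₀ (by fun_prop) fun θ => (circleDensity_base_pos t θ).ne'

theorem tau_diagMat (lam t : ℝ) : tau lam (diagMat t) =
    (2 * Real.pi)⁻¹ * ∫ θ in (0:ℝ)..(2 * Real.pi), circleDensity t θ ^ (lam / 2) := by
  unfold tau
  congr 1
  refine intervalIntegral.integral_congr fun θ _ => ?_
  have : (diagMat t *ᵥ (kmat θ *ᵥ ![1, 0])) ⬝ᵥ (diagMat t *ᵥ (kmat θ *ᵥ ![1, 0]))
      = (circleDensity t θ)⁻¹ := by
    simp [circleDensity, diagMat, kmat, Matrix.mulVec, dotProduct]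
    ring
  simp only [this]
  rw [Real.sqrt_inv, Real.rpow_neg (by positivity), Real.inv_rpow (Real.sqrt_nonneg _), inv_inv,
    Real.sqrt_eq_rpow, ← Real.rpow_mul (circleDensity_pos t θ).le]
  congr 1
  ring

theorem integral_circleDensity (t : ℝ) :
    ∫ θ in (0:ℝ)..(2 * Real.pi), circleDensity t θ = 2 * Real.pi := by
  set m := Real.exp (-t) ^ 2 with hm
  have hm0 : 0 < m := by positivity
  have hm1 : Real.exp t ^ 2 * m = 1 := by
    rw [hm, ← mul_pow, ← Real.exp_add]
    simp
  have hE : Real.exp t ^ 2 = m⁻¹ := eq_inv_of_mul_eq_one_left hm1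
  have hden (θ : ℝ) : 0 < Real.cos θ ^ 2 + m * Real.sin θ ^ 2 := by
    nlinarith [Real.sin_sq_add_cos_sq θ, mul_nonneg hm0.le (sq_nonneg (Real.sin θ)),
      sq_nonneg (Real.cos θ), mul_pos hm0 hm0, mul_nonneg hm0.le (sq_nonneg (Real.cos θ))]
  set F : ℝ → ℝ := fun θ => θ + Real.arctan
    ((m - 1) * (Real.sin θ * Real.cos θ) / (Real.cos θ ^ 2 + m * Real.sin θ ^ 2)) with hF
  have hderiv (θ : ℝ) : HasDerivAt F (circleDensity t θ) θ := by
    have hs := Real.hasDerivAt_sin θ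
    have hc := Real.hasDerivAt_cos θ
    have h := (hasDerivAt_id θ).add
      ((((hs.mul hc).const_mul (m - 1)).div ((hc.pow 2).add ((hs.pow 2).const_mul m))
        (hden θ).ne').arctan)
    refine h.congr_deriv ?_
    have hd := hden θ
    have hbase : 0 < Real.cos θ ^ 2 + m ^ 2 * Real.sin θ ^ 2 := by
      have := circleDensity_base_pos t θ
      rw [hE, ← hm] at this
      have h' := mul_pos hm0 this
      rwa [mul_add, ← mul_assoc, ← mul_assoc, mul_inv_cancel₀ hm0.ne', one_mul, ← sq] at h'
    have hsq : (Real.cos θ ^ 2 + m * Real.sin θ ^ 2) ^ 2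
        + ((m - 1) * (Real.sin θ * Real.cos θ)) ^ 2
        = Real.cos θ ^ 2 + m ^ 2 * Real.sin θ ^ 2 := by
      linear_combination (Real.cos θ ^ 2 + m ^ 2 * Real.sin θ ^ 2) * Real.sin_sq_add_cos_sq θ
    have hone : 1 + ((m - 1) * (Real.sin θ * Real.cos θ) /
        (Real.cos θ ^ 2 + m * Real.sin θ ^ 2)) ^ 2
        = (Real.cos θ ^ 2 + m ^ 2 * Real.sin θ ^ 2) /
          (Real.cos θ ^ 2 + m * Real.sin θ ^ 2) ^ 2 := by
      rw [← hsq]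
      field_simp
    have hdens : circleDensity t θ = m / (Real.cos θ ^ 2 + m ^ 2 * Real.sin θ ^ 2) := by
      rw [circleDensity, hE, ← hm, eq_div_iff hbase.ne', inv_mul_eq_iff_eq_mul₀]
      · field_simp
      · have := circleDensity_base_pos t θ
        rw [hE, ← hm] at this
        exact this.ne'
    simp only [Pi.add_apply, Pi.mul_apply, Pi.pow_apply, Pi.div_apply]
    rw [hone, hdens]
    field_simp
    linear_combination ((m - 1) * (Real.cos θ ^ 2 - m * Real.sin θ ^ 2) + m) *
      Real.sin_sq_add_cos_sq θ
  rw [intervalIntegral.integral_eq_sub_of_hasDerivAt (fun θ _ => hderiv θ)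
    ((continuous_circleDensity t).intervalIntegrable _ _)]
  simp [hF]

theorem mul_sub_one_lt_rpow_sub_rpow {p q x : ℝ} (hp : 1 < p) (hq : 0 ≤ q) (hqp : q < p)
    (hx : 0 < x) (hx1 : x ≠ 1) : (p - q) * (x - 1) < x ^ p - x ^ q := by
  have hs : -1 ≤ x - 1 := by linarith
  have hs' : x - 1 ≠ 0 := sub_ne_zero.2 hx1
  rcases le_total q 1 with h | h
  · have h₁ := one_add_mul_self_lt_rpow_one_add hs hs' hp
    have h₂ := rpow_one_add_le_one_add_mul_self hs hq h
    rw [add_sub_cancel] at h₁ h₂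
    linarith
  · have h₁ := one_add_mul_self_lt_rpow_one_add hs hs' (p := 1 + (p - q)) (by linarith)
    rw [add_sub_cancel, Real.rpow_add hx, Real.rpow_one] at h₁
    have h₂ : x ^ p = x ^ q * x ^ (p - q) := by
      rw [← Real.rpow_add hx, add_sub_cancel]
    have h₃ : x * (x ^ (p - q) - 1) ≤ x ^ q * (x ^ (p - q) - 1) := by
      rcases le_total x 1 with hx' | hx'
      · refine mul_le_mul_of_nonpos_right ?_
          (sub_nonpos.2 (Real.rpow_le_one hx.le hx' (by linarith)))
        simpa using Real.rpow_le_rpow_of_exponent_ge hx hx' h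
      · refine mul_le_mul_of_nonneg_right ?_
          (sub_nonneg.2 (Real.one_le_rpow hx' (by linarith)))
        simpa using Real.rpow_le_rpow_of_exponent_le hx' h
    rw [h₂]
    linarith

theorem tau_diagMat_lt {lam η t : ℝ} (hlam : 2 < lam) (hη : 0 ≤ η) (hηlam : η < lam)
    (ht : 0 < t) : tau η (diagMat t) < tau lam (diagMat t) := by
  rw [tau_diagMat, tau_diagMat]
  refine mul_lt_mul_of_pos_left ?_ (by positivity)
  have hX := continuous_circleDensity t
  have hXp (p : ℝ) : Continuous fun θ => circleDensity t θ ^ p :=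
    hX.rpow_const fun θ => Or.inl (circleDensity_pos t θ).ne'
  have hlt (θ : ℝ) (h : circleDensity t θ ≠ 1) :=
    mul_sub_one_lt_rpow_sub_rpow (p := lam / 2) (q := η / 2) (by linarith) (by linarith)
      (by linarith) (circleDensity_pos t θ) h
  have hle (θ : ℝ) : (lam / 2 - η / 2) * (circleDensity t θ - 1) ≤
      circleDensity t θ ^ (lam / 2) - circleDensity t θ ^ (η / 2) := by
    rcases eq_or_ne (circleDensity t θ) 1 with h | h
    · simp [h]
    · exact (hlt θ h).le
  have h₀ : circleDensity t 0 ≠ 1 := by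
    simp [circleDensity, ← Real.exp_nat_mul, ht.ne']
  have key := intervalIntegral.integral_lt_integral_of_continuousOn_of_le_of_exists_lt
    (a := 0) (b := 2 * Real.pi) (by positivity)
    (continuous_const.mul (hX.sub continuous_const)).continuousOn
    ((hXp (lam / 2)).sub (hXp (η / 2))).continuousOn (fun θ _ => hle θ)
    ⟨0, ⟨le_rfl, by positivity⟩, hlt 0 h₀⟩
  simp only [Pi.mul_apply, Pi.sub_apply] at key
  rw [intervalIntegral.integral_sub ((hXp _).intervalIntegrable _ _)
    ((hXp _).intervalIntegrable _ _), intervalIntegral.integral_const_mul,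
    intervalIntegral.integral_sub (hX.intervalIntegrable _ _) (by simp),
    integral_circleDensity] at key
  simpa using key

theorem tau_zero (g : M₂) : tau 0 g = 1 := by
  rw [tau_eq]
  refine (rotMean_congr fun θ => ?_).trans (rotMean_const 1)
  simp

theorem one_lt_tau_diagMat {lam t : ℝ} (hlam : 2 < lam) (ht : 0 < t) :
    1 < tau lam (diagMat t) := by
  simpa [tau_zero] using tau_diagMat_lt hlam le_rfl (by linarith) ht

theorem tau_diagMat_mono {lam s t : ℝ} (hlam : 2 < lam) (hs : 0 ≤ s) (hst : s ≤ t) :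
    tau lam (diagMat s) ≤ tau lam (diagMat t) := by
  have hT : Continuous fun r => tau lam (diagMat r) :=
    continuous_tau lam continuous_diagMat det_diagMat
  obtain ⟨r, hr, hmax⟩ := isCompact_Icc.exists_isMaxOn
    (Set.nonempty_Icc.2 (hs.trans hst)) hT.continuousOn
  rcases hr.2.eq_or_lt with rfl | hrt
  · exact hmax ⟨hs, hst⟩
  · have hmean := rotMean_tau_mul lam (det_diagMat (t - r)) (det_diagMat r)
    have hle : rotMean (fun k => tau lam (diagMat (t - r) * k * diagMat r)) ≤
        rotMean fun _ => tau lam (diagMat r) := by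
      refine rotMean_mono (continuous_tau lam ?_ ?_) continuous_const fun θ => ?_
      · have := continuous_kmat
        fun_prop
      · simp [det_diagMat, det_kmat]
      · obtain ⟨ρ, hρ, α, β, h⟩ :=
          exists_cartan_diagMat_mul (t - r) r θ (by linarith) hr.1
        rw [h, tau_mul_kmat, tau_kmat_mul]
        rw [sub_add_cancel] at hρ
        exact hmax hρ
    rw [hmean, rotMean_const] at hle
    have h₁ := one_lt_tau_diagMat hlam (sub_pos.2 hrt)
    have h₂ := tau_pos lam (det_diagMat r)
    nlinarith

end Tau

section MaximumPrinciple

theorem continuous_comp_of_continuousOn_det {f : M₂ → ℝ} (hf : ContinuousOn f {h | h.det = 1})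
    {X : Type*} [TopologicalSpace X] {γ : X → M₂} (hγ : Continuous γ)
    (hdet : ∀ x, (γ x).det = 1) : Continuous fun x => f (γ x) :=
  hf.comp_continuous hγ hdet

/-- A radial supersolution `F` of the mean value equation satisfied by `τ_λ` lies below
`F(1) τ_λ` at some point of every sufficiently long radial interval. -/
theorem exists_le_mul_tau_of_rotMean_le {F : M₂ → ℝ} {lam c : ℝ} (hc : 0 < c)
    (hF : ContinuousOn F {h | h.det = 1})
    (hleft : ∀ θ h, h.det = 1 → F (kmat θ * h) = F h)
    (hright : ∀ θ h, h.det = 1 → F (h * kmat θ) = F h)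
    (hmean : ∀ t, 0 ≤ t → rotMean (fun k => F (diagMat c * k * diagMat t)) ≤
      tau lam (diagMat c) * F (diagMat t)) {T : ℝ} (hT : 0 ≤ T) :
    ∃ t ∈ Set.Icc 0 T, T - t < c ∧ F (diagMat t) ≤ F 1 * tau lam (diagMat t) := by
  have hFD : Continuous fun t => F (diagMat t) :=
    continuous_comp_of_continuousOn_det hF continuous_diagMat det_diagMat
  have hτD : Continuous fun t => tau lam (diagMat t) :=
    continuous_tau lam continuous_diagMat det_diagMat
  have hτpos (t : ℝ) := tau_pos lam (det_diagMat t)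
  have hω : Continuous fun t => F (diagMat t) / tau lam (diagMat t) :=
    hFD.div hτD fun t => (hτpos t).ne'
  obtain ⟨t₀, ht₀, hmin⟩ :=
    isCompact_Icc.exists_isMinOn (Set.nonempty_Icc.2 hT) hω.continuousOn
  set m := F (diagMat t₀) / tau lam (diagMat t₀) with hm
  have hlow : ∀ t ∈ Set.Icc 0 T, m * tau lam (diagMat t) ≤ F (diagMat t) := fun t ht =>
    (le_div_iff₀ (hτpos t)).1 (hmin ht)
  have hcompact : IsCompact (Set.Icc 0 T ∩ {t | F (diagMat t) = m * tau lam (diagMat t)}) :=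
    isCompact_Icc.inter_right (isClosed_eq hFD (continuous_const.mul hτD))
  obtain ⟨t, ⟨ht, hFt⟩, hlast⟩ := hcompact.exists_isGreatest
    ⟨t₀, ht₀, (div_eq_iff (hτpos t₀).ne').1 hm.symm⟩
  rw [Set.mem_ofPred_eq] at hFt
  refine ⟨t, ht, ?_, ?_⟩
  · by_contra! hct
    have hne : m * tau lam (diagMat (c + t)) < F (diagMat (c + t)) := by
      refine (hlow _ ⟨by linarith [ht.1], by linarith⟩).lt_of_ne fun h => ?_
      have := hlast ⟨⟨by linarith [ht.1], by linarith⟩, h.symm⟩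
      linarith
    have hγ : Continuous fun θ => diagMat c * kmat θ * diagMat t := by
      have := continuous_kmat
      fun_prop
    have hdet (θ : ℝ) : (diagMat c * kmat θ * diagMat t).det = 1 := by
      simp [det_diagMat, det_kmat]
    have hlt := rotMean_lt (F := fun k => m * tau lam (diagMat c * k * diagMat t))
      (H := fun k => F (diagMat c * k * diagMat t))
      (continuous_const.mul (continuous_tau lam hγ hdet))
      (continuous_comp_of_continuousOn_det hF hγ hdet) (fun θ => ?_) 0
      (by simpa only [kmat_zero, mul_one, ← diagMat_add] using hne)
    · rw [rotMean_const_mul, rotMean_tau_mul lam (det_diagMat c) (det_diagMat t)] at hlt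
      have := hmean t ht.1
      rw [hFt] at this
      linarith
    · obtain ⟨r, hr, α, β, h⟩ := exists_cartan_diagMat_mul c t θ hc.le ht.1
      simp only [h]
      rw [tau_mul_kmat, tau_kmat_mul, hright _ _ (by simp [det_diagMat, det_kmat]),
        hleft _ _ (det_diagMat r)]
      exact hlow r ⟨hr.1, by linarith [hr.2]⟩
  · rw [hFt]
    refine mul_le_mul_of_nonneg_right ?_ (hτpos t).le
    simpa [diagMat_zero, tau_one] using hlow 0 ⟨le_rfl, hT⟩

end MaximumPrinciple

section RightMean

/-- The average of `f` over the coset `h SO(2)`. -/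
noncomputable def rightMean (f : Matrix (Fin 2) (Fin 2) ℝ → ℝ)
    (h : Matrix (Fin 2) (Fin 2) ℝ) : ℝ :=
  rotMean fun k => f (h * k)

theorem rightMean_mul_kmat (f : M₂ → ℝ) (h : M₂) (θ : ℝ) :
    rightMean f (h * kmat θ) = rightMean f h := by
  simp only [rightMean, mul_assoc]
  exact rotMean_mul_left (fun k => f (h * k)) θ

variable {f : Matrix (Fin 2) (Fin 2) ℝ → ℝ}

theorem continuous_rightMean (hf : ContinuousOn f {h | h.det = 1}) {X : Type*}
    [TopologicalSpace X] {γ : X → M₂} (hγ : Continuous γ) (hdet : ∀ x, (γ x).det = 1) :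
    Continuous fun x => rightMean f (γ x) := by
  refine continuous_rotMean (continuous_comp_of_continuousOn_det hf ?_ ?_)
  · have := continuous_kmat
    fun_prop
  · simp [hdet, det_kmat]

theorem rightMean_kmat_mul (hfK : ∀ (θ : ℝ) (h : M₂), h.det = 1 → f (kmat θ * h) = f h)
    (θ : ℝ) {h : M₂} (hh : h.det = 1) : rightMean f (kmat θ * h) = rightMean f h := by
  refine rotMean_congr fun φ => ?_
  rw [mul_assoc, hfK _ _ (by simp [hh, det_kmat])]

theorem rightMean_one (hfK : ∀ (θ : ℝ) (h : M₂), h.det = 1 → f (kmat θ * h) = f h) :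
    rightMean f 1 = f 1 := by
  refine (rotMean_congr fun φ => ?_).trans (rotMean_const (f 1))
  rw [one_mul, ← hfK φ 1 Matrix.det_one, mul_one]

theorem rightMean_mul_le (hf : ContinuousOn f {h | h.det = 1}) {y h : M₂} {Qc : ℝ}
    (hy : y.det = 1) (hh : h.det = 1) (hle : ∀ h : M₂, h.det = 1 → f (y * h) ≤ Qc * f h) :
    rightMean f (y * h) ≤ Qc * rightMean f h := by
  rw [rightMean, rightMean, ← rotMean_const_mul]
  have hk := continuous_kmat
  refine rotMean_mono
    (continuous_comp_of_continuousOn_det hf (by fun_prop) (by simp [hy, hh, det_kmat]))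
    (continuous_const.mul
      (continuous_comp_of_continuousOn_det hf (by fun_prop) (by simp [hh, det_kmat])))
    fun θ => ?_
  rw [mul_assoc]
  exact hle _ (by simp [hh, det_kmat])

theorem rotMean_rightMean_le (hf : ContinuousOn f {h | h.det = 1}) {g : M₂}
    (hg : g.det = 1) {lam η b : ℝ}
    (hA : ∀ h : M₂, h.det = 1 → Ag g f h ≤ tau lam g * f h + b * tau η h)
    {h : M₂} (hh : h.det = 1) :
    rotMean (fun k => rightMean f (g * k * h)) ≤
      tau lam g * rightMean f h + b * tau η h := by
  have hk := continuous_kmat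
  have hdet (θ φ : ℝ) : (g * kmat θ * h * kmat φ).det = 1 := by simp [hg, hh, det_kmat]
  have hγ : Continuous fun p : ℝ × ℝ => g * kmat p.1 * h * kmat p.2 := by fun_prop
  have hγ' : Continuous fun θ => h * kmat θ := by fun_prop
  have hcont := continuous_comp_of_continuousOn_det hf hγ fun p => hdet _ _
  have hcont' := continuous_comp_of_continuousOn_det hf hγ' (by simp [hh, det_kmat])
  have hγ'' : Continuous fun p : ℝ × ℝ => g * kmat p.2 * h * kmat p.1 := by fun_prop
  have hswap := continuous_comp_of_continuousOn_det hf hγ'' fun p => hdet _ _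
  have hscaled : Continuous fun θ => tau lam g * f (h * kmat θ) := continuous_const.mul hcont'
  have hcomm := rotMean_comm (F := fun k l => f (g * k * h * l)) hcont
  calc
    rotMean (fun k => rightMean f (g * k * h))
      = rotMean fun l => rotMean fun k => f (g * k * h * l) := hcomm
    _ ≤ rotMean fun l => tau lam g * f (h * l) + b * tau η h := by
        refine rotMean_mono (F := fun l => rotMean fun k => f (g * k * h * l))
          (H := fun l => tau lam g * f (h * l) + b * tau η h)
          (continuous_rotMean (F := fun φ k => f (g * k * h * kmat φ))
            hswap) (hscaled.add continuous_const) fun φ => ?_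
        · have := hA (h * kmat φ) (by simp [hh, det_kmat])
          rw [tau_mul_kmat] at this
          simpa only [Ag, rotMean, ← mul_assoc] using this
    _ = tau lam g * rightMean f h + b * tau η h := by
        rw [rotMean_add (F := fun l => tau lam g * f (h * l)) (H := fun _ => b * tau η h)
          hscaled continuous_const, rotMean_const_mul, rotMean_const]
        rfl

end RightMean

/-- Lemma 6.1 of Götze–Margulis. -/
theorem stmt15 (g : Matrix (Fin 2) (Fin 2) ℝ) (hg : g.det = 1) (hgK : ¬ gᵀ * g = 1)
    (lam η b Qc : ℝ) (hlam : 2 < lam) (hη0 : 0 < η) (hetalam : η < lam)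
    (hb : 0 ≤ b) (hQc : 1 < Qc)
    (f : Matrix (Fin 2) (Fin 2) ℝ → ℝ)
    (hfc : ContinuousOn f {h | h.det = 1})
    (hfpos : ∀ h : Matrix (Fin 2) (Fin 2) ℝ, h.det = 1 → 0 < f h)
    (hfK : ∀ (θ : ℝ) (h : Matrix (Fin 2) (Fin 2) ℝ), h.det = 1 → f (kmat θ * h) = f h)
    (h1 : ∀ h : Matrix (Fin 2) (Fin 2) ℝ, h.det = 1 →
      Ag g f h ≤ tau lam g * f h + b * tau η h)
    (h2 : ∀ y h : Matrix (Fin 2) (Fin 2) ℝ, y.det = 1 → h.det = 1 →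
      opNorm y ≤ opNorm g → f (y * h) ≤ Qc * f h) :
    ∀ h : Matrix (Fin 2) (Fin 2) ℝ, h.det = 1 →
      (2 * Real.pi)⁻¹ * (∫ θ in (0:ℝ)..(2 * Real.pi), f (h * kmat θ))
        ≤ (Qc * (f 1 + b / (tau lam g - tau η g))) * tau lam h := by
  intro h hh
  obtain ⟨θ, φ, c, hc, rfl⟩ := exists_cartan g hg
  obtain ⟨α, β, T, hT, rfl⟩ := exists_cartan h hh
  have hc0 : 0 < c := by
    refine hc.lt_of_ne fun h0 => hgK ?_
    rw [← h0, diagMat_zero, mul_one, ← kmat_add]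
    have ht : ∀ x, (kmat x)ᵀ = kmat (-x) := fun x => by
      ext i j
      fin_cases i <;> fin_cases j <;> simp [kmat]
    rw [ht, kmat_neg_mul]
  simp only [tau_mul_kmat, tau_kmat_mul] at h1 ⊢
  set C := b / (tau lam (diagMat c) - tau η (diagMat c)) with hC
  have hgap := sub_pos.2 (tau_diagMat_lt hlam hη0.le hetalam hc0)
  have hC0 : 0 ≤ C := div_nonneg hb hgap.le
  have hCb : C * (tau lam (diagMat c) - tau η (diagMat c)) = b := div_mul_cancel₀ _ hgap.ne'
  have hk := continuous_kmat
  have hsuper (t : ℝ) (_ : 0 ≤ t) :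
      rotMean (fun k => rightMean f (diagMat c * k * diagMat t) +
        C * tau η (diagMat c * k * diagMat t)) ≤
      tau lam (diagMat c) * (rightMean f (diagMat t) + C * tau η (diagMat t)) := by
    have hdet (ψ : ℝ) : (diagMat c * kmat ψ * diagMat t).det = 1 := by
      simp [det_diagMat, det_kmat]
    have hmean := rotMean_rightMean_le hfc hg (lam := lam) (η := η) (b := b)
      (by simpa only [tau_mul_kmat, tau_kmat_mul] using h1) (det_diagMat t)
    have hrot : rotMean (fun k => rightMean f (kmat θ * diagMat c * kmat φ * k * diagMat t)) =
        rotMean fun k => rightMean f (diagMat c * k * diagMat t) := by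
      rw [← rotMean_mul_left (fun k => rightMean f (diagMat c * k * diagMat t)) φ]
      refine rotMean_congr fun ψ => ?_
      simp only [mul_assoc]
      exact rightMean_kmat_mul hfK _ (by simp [det_diagMat, det_kmat])
    rw [hrot, tau_mul_kmat, tau_kmat_mul] at hmean
    have hγ : Continuous fun ψ => diagMat c * kmat ψ * diagMat t := by fun_prop
    rw [rotMean_add (F := fun k => rightMean f (diagMat c * k * diagMat t))
      (H := fun k => C * tau η (diagMat c * k * diagMat t)) (continuous_rightMean hfc hγ hdet)
      (continuous_const.mul (continuous_tau η hγ hdet)), rotMean_const_mul,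
      rotMean_tau_mul η (det_diagMat c) (det_diagMat t)]
    calc
      _ ≤ tau lam (diagMat c) * rightMean f (diagMat t) + b * tau η (diagMat t)
          + C * (tau η (diagMat c) * tau η (diagMat t)) := by gcongr
      _ = _ := by
        rw [← hCb]
        ring
  obtain ⟨t, ht, htT, hle⟩ := exists_le_mul_tau_of_rotMean_le
    (F := fun h => rightMean f h + C * tau η h) hc0
    (continuousOn_iff_continuous_domRestrict.2
      ((continuous_rightMean hfc continuous_subtype_val fun x => x.2).add
        (continuous_const.mul (continuous_tau η continuous_subtype_val fun x => x.2))))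
    (fun ψ h hh => by rw [rightMean_kmat_mul hfK _ hh, tau_kmat_mul])
    (fun ψ h _ => by rw [rightMean_mul_kmat, tau_mul_kmat]) hsuper hT
  simp only [rightMean_one hfK, tau_one, mul_one] at hle
  have hdom : rightMean f (diagMat T) ≤ Qc * rightMean f (diagMat t) := by
    have hsplit : diagMat T = diagMat (T - t) * diagMat t := by
      rw [← diagMat_add, sub_add_cancel]
    rw [hsplit]
    refine rightMean_mul_le hfc (det_diagMat _) (det_diagMat _) fun h hh =>
      h2 _ h (det_diagMat _) hh ?_
    rw [opNorm_cartan _ _ _ hc, opNorm_diagMat _ (sub_nonneg.2 ht.2)]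
    exact Real.exp_le_exp.2 htT.le
  have hf1 := hfpos 1 Matrix.det_one
  have hη := tau_pos η (det_diagMat t)
  calc
    rightMean f (kmat α * diagMat T * kmat β)
      = rightMean f (diagMat T) := by
        rw [rightMean_mul_kmat, rightMean_kmat_mul hfK _ (det_diagMat T)]
    _ ≤ Qc * rightMean f (diagMat t) := hdom
    _ ≤ Qc * ((f 1 + C) * tau lam (diagMat t)) := by
        gcongr
        exact le_trans (le_add_of_nonneg_right (by positivity)) hle
    _ ≤ Qc * ((f 1 + C) * tau lam (diagMat T)) := by
        gcongr
        exact tau_diagMat_mono hlam ht.1 ht.2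
    _ = Qc * (f 1 + C) * tau lam (diagMat T) := by ring
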